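/- Let N > max{2,p}, 1 < p < N, 0 < μ < N, a, b > 0, 1 ≤ θ < (2N−μ)/(N−p), V∞ > 0, set p_{*,μ} := p(2N−μ)/(2N) and p*_μ := p(2N−μ)/(2(N−p)), let q ∈ (p_{*,μ}, p*_μ), and let F : ℝ → ℝ satisfy |F(t)| ≤ C₀(|t|^{p_{*,μ}} + |t|^q) for all t and some C₀ > 0. Let V : ℝ^N → ℝ be continuously differentiable with sup_{x} V(x) < ∞, ⟨∇V(x), x⟩ ≤ 0 for all x, and N·V(x) + ⟨∇V(x), x⟩ ≥ N·V∞ for all x. For continuously differentiable, compactly supported u : ℝ^N → ℝ define ‖u‖ := (a∫‖∇u‖^p + ∫V(x)|u|^p)^{1/p}, D(u) := ∬ F(u(x))F(u(y))/‖x−y‖^μ dx dy, J(u) := (a/p)∫‖∇u‖^p + (b/(pθ))(∫‖∇u‖^p)^θ + (1/p)∫V(x)|u|^p − D(u)/2, and P(u) := ((N−p)a/p)∫‖∇u‖^p + ((N−p)b/p)(∫‖∇u‖^p)^θ + (1/p)∫(N·V(x) + ⟨∇V(x),x⟩)|u|^p − ((2N−μ)/2)·D(u). Then there exist σ₁, σ₂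 > 0 such that every continuously differentiable, compactly supported u ≢ 0 with P(u) = 0 satisfies ‖u‖ > σ₁ and J(u) ≥ σ₂. -/

import Mathlib

open MeasureTheory RealInnerProductSpace

/-- The `p`-Dirichlet energy `∫‖∇u‖^p`. -/
noncomputable def pDirichlet (N : ℕ) (p : ℝ) (u : EuclideanSpace ℝ (Fin N) → ℝ) : ℝ :=
  ∫ x, ‖fderiv ℝ u x‖ ^ p

/-- The `L^p` mass `∫|u|^p`. -/
noncomputable def pMass (N : ℕ) (p : ℝ) (u : EuclideanSpace ℝ (Fin N) → ℝ) : ℝ :=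
  ∫ x, |u x| ^ p

/-- The Choquard term `D(u) = ∬ F(u(x))F(u(y))/‖x-y‖^μ dx dy`. -/
noncomputable def choquardTerm (N : ℕ) (μ : ℝ) (F : ℝ → ℝ)
    (u : EuclideanSpace ℝ (Fin N) → ℝ) : ℝ :=
  ∫ x, ∫ y, F (u x) * F (u y) / ‖x - y‖ ^ μ

/-- The energy functional `J` of the `p`-Kirchhoff–Choquard problem. -/
noncomputable def energyJ (N : ℕ) (p μ a b θ : ℝ) (F : ℝ → ℝ)
    (V : EuclideanSpace ℝ (Fin N) → ℝ) (u : EuclideanSpace ℝ (Fin N) → ℝ) : ℝ :=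
  (a / p) * pDirichlet N p u + (b / (p * θ)) * pDirichlet N p u ^ θ
    + (1 / p) * (∫ x, V x * |u x| ^ p) - choquardTerm N μ F u / 2

/-- The Poho\v{z}aev functional `P` of the `p`-Kirchhoff–Choquard problem. -/
noncomputable def pohozaevP (N : ℕ) (p μ a b θ : ℝ) (F : ℝ → ℝ)
    (V : EuclideanSpace ℝ (Fin N) → ℝ) (u : EuclideanSpace ℝ (Fin N) → ℝ) : ℝ :=
  (((N : ℝ) - p) * a / p) * pDirichlet N p u
    + (((N : ℝ) - p) * b / p) * pDirichlet N p u ^ θ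
    + (1 / p) * (∫ x, ((N : ℝ) * V x + ⟪gradient V x, x⟫) * |u x| ^ p)
    - ((2 * N - μ) / 2) * choquardTerm N μ F u

lemma aux_near (N : ℕ) (hN : 0 < N) (μ : ℝ) (hμN : μ < N) :
    ∃ C > (0:ℝ), ∀ ρ > (0:ℝ), ∫⁻ z : EuclideanSpace ℝ (Fin N),
      ENNReal.ofReal ((Set.Iic ρ).indicator (fun t : ℝ => t ^ (-μ)) ‖z‖) ≤
        ENNReal.ofReal (C * ρ ^ ((N:ℝ) - μ)) := by
  have : Nonempty (Fin N) := ⟨⟨0, hN⟩⟩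
  have hd : Module.finrank ℝ (EuclideanSpace ℝ (Fin N)) = N := by simp
  have hNμ : 0 < (N:ℝ) - μ := by linarith
  set v : ℝ := (volume : Measure (EuclideanSpace ℝ (Fin N))).real (Metric.ball 0 1) with hv
  have hv0 : 0 < v := by
    rw [hv]
    exact ENNReal.toReal_pos (Metric.measure_ball_pos _ _ one_pos).ne' measure_ball_lt_top.ne
  refine ⟨N * (v * (1 / ((N:ℝ) - μ))), by positivity, fun ρ hρ => ?_⟩
  have heq : (fun y : ℝ => (Set.Ioc 0 ρ).indicator (fun t : ℝ => t ^ ((N:ℝ) - 1 - μ)) y) =ᵐ[volume.restrict (Set.Ioi 0)]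
      fun y => y ^ (Module.finrank ℝ (EuclideanSpace ℝ (Fin N)) - 1) • (Set.Iic ρ).indicator (fun t : ℝ => t ^ (-μ)) y := by
    filter_upwards [ae_restrict_mem measurableSet_Ioi] with y hy
    have hy' : 0 < y := hy
    by_cases h : y ≤ ρ
    · rw [Set.indicator_of_mem (by exact ⟨hy', h⟩), Set.indicator_of_mem (by exact h), hd, smul_eq_mul,
        ← Real.rpow_natCast, ← Real.rpow_add hy']
      congr 1
      rw [Nat.cast_pred hN]; ring
    · rw [Set.indicator_of_notMem (by exact fun h' => h h'.2), Set.indicator_of_notMem (by exact h), smul_zero]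
  have hint0 : IntegrableOn (fun t : ℝ => t ^ ((N:ℝ) - 1 - μ)) (Set.Ioc 0 ρ) := by
    rw [integrableOn_Ioc_iff_integrableOn_Ioo, intervalIntegral.integrableOn_Ioo_rpow_iff hρ]; linarith
  have hint : IntegrableOn (fun y : ℝ => (Set.Ioc 0 ρ).indicator (fun t : ℝ => t ^ ((N:ℝ) - 1 - μ)) y) (Set.Ioi 0) :=
    ((integrable_indicator_iff measurableSet_Ioc).2 hint0).integrableOn
  have hI := (integrable_fun_norm_addHaar (volume : Measure (EuclideanSpace ℝ (Fin N)))).2 (hint.congr heq)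
  rw [← ofReal_integral_eq_lintegral_ofReal hI]
  · refine ENNReal.ofReal_le_ofReal (le_of_eq ?_)
    rw [integral_fun_norm_addHaar, ← integral_congr_ae heq, setIntegral_indicator measurableSet_Ioc,
      hd, ← hv, Set.inter_eq_self_of_subset_right (fun x hx => hx.1),
      ← intervalIntegral.integral_of_le hρ.le, integral_rpow (Or.inl (by linarith)),
      Real.zero_rpow (by linarith)]
    simp only [nsmul_eq_mul, smul_eq_mul]
    rw [show (N:ℝ) - 1 - μ + 1 = N - μ by ring]
    field_simp
    ring
  · refine Filter.Eventually.of_forall fun z => ?_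
    simp only [Set.indicator_apply, Pi.zero_apply]
    split_ifs <;> positivity

lemma aux_far (N : ℕ) (hN : 0 < N) :
    ∃ C > (0:ℝ), ∀ ρ > (0:ℝ), ∫⁻ z : EuclideanSpace ℝ (Fin N),
      ENNReal.ofReal ((Set.Ioi ρ).indicator (fun t : ℝ => t ^ (-(2 * N : ℝ))) ‖z‖) ≤
        ENNReal.ofReal (C * ρ ^ (-(N:ℝ))) := by
  have : Nonempty (Fin N) := ⟨⟨0, hN⟩⟩
  have hd : Module.finrank ℝ (EuclideanSpace ℝ (Fin N)) = N := by simp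
  have hN' : 0 < (N:ℝ) := by exact_mod_cast hN
  set v : ℝ := (volume : Measure (EuclideanSpace ℝ (Fin N))).real (Metric.ball 0 1) with hv
  have hv0 : 0 < v := by
    rw [hv]
    exact ENNReal.toReal_pos (Metric.measure_ball_pos _ _ one_pos).ne' measure_ball_lt_top.ne
  refine ⟨N * (v * (1 / (N:ℝ))), by positivity, fun ρ hρ => ?_⟩
  have heq : (fun y : ℝ => (Set.Ioi ρ).indicator (fun t : ℝ => t ^ (-(N:ℝ) - 1)) y) =ᵐ[volume.restrict (Set.Ioi 0)]
      fun y => y ^ (Module.finrank ℝ (EuclideanSpace ℝ (Fin N)) - 1) • (Set.Ioi ρ).indicator (fun t : ℝ => t ^ (-(2 * N : ℝ))) y := by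
    filter_upwards [ae_restrict_mem measurableSet_Ioi] with y hy
    have hy' : 0 < y := hy
    by_cases h : ρ < y
    · rw [Set.indicator_of_mem (by exact h), Set.indicator_of_mem (by exact h), hd, smul_eq_mul,
        ← Real.rpow_natCast, ← Real.rpow_add hy']
      congr 1
      rw [Nat.cast_pred hN]; ring
    · rw [Set.indicator_of_notMem (by exact h), Set.indicator_of_notMem (by exact h), smul_zero]
  have hint0 : IntegrableOn (fun t : ℝ => t ^ (-(N:ℝ) - 1)) (Set.Ioi ρ) :=
    integrableOn_Ioi_rpow_of_lt (by linarith) hρ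
  have hint : IntegrableOn (fun y : ℝ => (Set.Ioi ρ).indicator (fun t : ℝ => t ^ (-(N:ℝ) - 1)) y) (Set.Ioi 0) :=
    ((integrable_indicator_iff measurableSet_Ioi).2 hint0).integrableOn
  have hI := (integrable_fun_norm_addHaar (volume : Measure (EuclideanSpace ℝ (Fin N)))).2 (hint.congr heq)
  rw [← ofReal_integral_eq_lintegral_ofReal hI]
  · refine ENNReal.ofReal_le_ofReal (le_of_eq ?_)
    rw [integral_fun_norm_addHaar, ← integral_congr_ae heq, setIntegral_indicator measurableSet_Ioi,
      hd, ← hv, Set.inter_eq_self_of_subset_right (Set.Ioi_subset_Ioi hρ.le), 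
      integral_Ioi_rpow_of_lt (by linarith) hρ]
    simp only [nsmul_eq_mul, smul_eq_mul]
    rw [show -(N:ℝ) - 1 + 1 = -N by ring]
    field_simp
  · refine Filter.Eventually.of_forall fun z => Set.indicator_nonneg (fun t ht => ?_) _ 
    exact Real.rpow_nonneg (hρ.le.trans (le_of_lt ht)) _


lemma aux_inner (N : ℕ) (hN : 0 < N) (μ : ℝ) (hμ0 : 0 < μ) (hμN : μ < N) :
    ∃ C > (0:ℝ), ∀ g : EuclideanSpace ℝ (Fin N) → ℝ, Measurable g → (∀ x, 0 ≤ g x) →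
      ∀ M > (0:ℝ), ∫⁻ y, ENNReal.ofReal (g y) ^ (2 * N / (2 * N - μ)) ≤
        ENNReal.ofReal M ^ (2 * N / (2 * N - μ)) → ∀ t > (0:ℝ), ∀ x,
      ∫⁻ y, ENNReal.ofReal (min (g y) t * ‖x - y‖ ^ (-μ)) ≤
        ENNReal.ofReal (C * (t ^ (μ / (2 * N - μ)) * M ^ (2 * (N - μ) / (2 * N - μ)))) := by
  obtain ⟨C₁, hC₁, h1⟩ := aux_near N hN μ hμN
  obtain ⟨C₂, hC₂, h2⟩ := aux_far N hN
  have hN' : 0 < (N:ℝ) := by exact_mod_cast hN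
  have hd : 0 < 2 * (N:ℝ) - μ := by linarith
  refine ⟨C₁ + C₂ ^ (μ / (2 * N)), by positivity, fun g hgm hg0 M hM hgM t ht x => ?_⟩
  set ρ : ℝ := (M / t) ^ (2 / (2 * N - μ)) with hρdef
  have hρ : 0 < ρ := by positivity
  set kn : EuclideanSpace ℝ (Fin N) → ENNReal := fun z =>
    ENNReal.ofReal ((Set.Iic ρ).indicator (fun t : ℝ => t ^ (-μ)) ‖z‖) with hkn
  set kf : EuclideanSpace ℝ (Fin N) → ENNReal := fun z =>
    ENNReal.ofReal ((Set.Ioi ρ).indicator (fun t : ℝ => t ^ (-μ)) ‖z‖) with hkf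
  have hknm : Measurable kn := by
    exact ENNReal.measurable_ofReal.comp (Measurable.comp (g := (Set.Iic ρ).indicator (fun t : ℝ => t ^ (-μ)))
      ((measurable_id.pow_const _).indicator measurableSet_Iic) measurable_norm)
  have hkfm : Measurable kf := by
    exact ENNReal.measurable_ofReal.comp (Measurable.comp (g := (Set.Ioi ρ).indicator (fun t : ℝ => t ^ (-μ)))
      ((measurable_id.pow_const _).indicator measurableSet_Ioi) measurable_norm)
  have hpt : ∀ y, ENNReal.ofReal (min (g y) t * ‖x - y‖ ^ (-μ)) ≤
      ENNReal.ofReal t * kn (x - y) + ENNReal.ofReal (g y) * kf (x - y) := by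
    intro y
    have hk : 0 ≤ ‖x - y‖ ^ (-μ) := by positivity
    by_cases h : ‖x - y‖ ≤ ρ
    · refine le_trans ?_ le_self_add
      simp only [hkn]
      rw [Set.indicator_of_mem (by exact h), ← ENNReal.ofReal_mul ht.le]
      exact ENNReal.ofReal_le_ofReal (mul_le_mul_of_nonneg_right (min_le_right _ _) hk)
    · refine le_trans ?_ le_add_self
      simp only [hkf]
      rw [Set.indicator_of_mem (by exact not_le.1 h), ← ENNReal.ofReal_mul (hg0 y)]
      exact ENNReal.ofReal_le_ofReal (mul_le_mul_of_nonneg_right (min_le_left _ _) hk)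
  have hsub : Measurable (fun y : EuclideanSpace ℝ (Fin N) => x - y) := measurable_const.sub measurable_id
  have hnear : ∫⁻ y, ENNReal.ofReal t * kn (x - y) ≤ ENNReal.ofReal (t * (C₁ * ρ ^ ((N:ℝ) - μ))) := by
    have hm : Measurable (fun y => kn (x - y)) := hknm.comp hsub
    rw [lintegral_const_mul _ hm, lintegral_sub_left_eq_self kn x,
      ENNReal.ofReal_mul ht.le]
    exact mul_le_mul_right (h1 ρ hρ) _
  have hfar : ∫⁻ y, ENNReal.ofReal (g y) * kf (x - y) ≤
      ENNReal.ofReal (M * (C₂ * ρ ^ (-(N:ℝ))) ^ (μ / (2 * N))) := by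
    have hconj : (2 * N / (2 * N - μ)).HolderConjugate (2 * N / μ) := by
      rw [Real.holderConjugate_iff]
      constructor
      · rw [lt_div_iff₀ hd]; linarith
      · field_simp; ring
    have hH := ENNReal.lintegral_mul_le_Lp_mul_Lq volume hconj (f := fun y => ENNReal.ofReal (g y))
      (g := fun y => kf (x - y)) hgm.ennreal_ofReal.aemeasurable (hkfm.comp hsub).aemeasurable
    refine hH.trans ?_
    rw [ENNReal.ofReal_mul hM.le]
    refine mul_le_mul' ?_ ?_
    · refine (ENNReal.rpow_le_rpow hgM (by positivity)).trans ?_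
      rw [← ENNReal.rpow_mul, mul_one_div_cancel (by positivity), ENNReal.rpow_one]
    · rw [← ENNReal.ofReal_rpow_of_nonneg (by positivity) (by positivity), one_div_div]
      refine ENNReal.rpow_le_rpow (le_trans (le_of_eq ?_) (h2 ρ hρ)) (by positivity)
      rw [lintegral_sub_left_eq_self (fun z => kf z ^ (2 * N / μ)) x]
      refine lintegral_congr fun z => ?_
      simp only [hkf]
      by_cases h : ‖z‖ ∈ Set.Ioi ρ
      · rw [Set.indicator_of_mem h, Set.indicator_of_mem h,
          ENNReal.ofReal_rpow_of_nonneg (by positivity) (by positivity), ← Real.rpow_mul (norm_nonneg _)]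
        congr 2
        field_simp
      · rw [Set.indicator_of_notMem h, Set.indicator_of_notMem h, ENNReal.ofReal_zero,
          ENNReal.zero_rpow_of_pos (by positivity)]
  refine (lintegral_mono hpt).trans ?_
  have hm : Measurable (fun y => ENNReal.ofReal t * kn (x - y)) := (hknm.comp hsub).const_mul _
  rw [lintegral_add_left hm]
  refine (add_le_add hnear hfar).trans ?_
  rw [← ENNReal.ofReal_add (by positivity) (by positivity)]
  refine ENNReal.ofReal_le_ofReal (le_of_eq ?_)
  have e1 : t * ρ ^ ((N:ℝ) - μ) = t ^ (μ / (2 * N - μ)) * M ^ (2 * (N - μ) / (2 * N - μ)) := by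
    rw [hρdef, ← Real.rpow_mul (by positivity), Real.div_rpow hM.le ht.le]
    rw [show t ^ (μ / (2 * N - μ)) = t ^ (1 - 2 / (2 * N - μ) * (N - μ)) by congr 1; field_simp; ring,
      Real.rpow_sub ht, Real.rpow_one,
      show 2 / (2 * N - μ) * (N - μ) = 2 * (N - μ) / (2 * N - μ) by ring]
    ring
  have e2 : M * (ρ ^ (-(N:ℝ))) ^ (μ / (2 * N)) = t ^ (μ / (2 * N - μ)) * M ^ (2 * (N - μ) / (2 * N - μ)) := by
    rw [hρdef, ← Real.rpow_mul (by positivity), ← Real.rpow_mul (by positivity),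
      show 2 / (2 * N - μ) * (-(N:ℝ) * (μ / (2 * N))) = -(μ / (2 * N - μ)) by field_simp,
      Real.rpow_neg (by positivity), Real.div_rpow hM.le ht.le,
      show 2 * (N - μ) / (2 * N - μ) = 1 - μ / (2 * N - μ) by field_simp; ring,
      Real.rpow_sub hM, Real.rpow_one]
    field_simp
  rw [Real.mul_rpow hC₂.le (by positivity)]
  linear_combination C₁ * e1 + C₂ ^ (μ / (2 * N)) * e2

lemma aux_hls (N : ℕ) (hN : 0 < N) (μ : ℝ) (hμ0 : 0 < μ) (hμN : μ < N) :
    ∃ C > (0:ℝ), ∀ g : EuclideanSpace ℝ (Fin N) → ℝ, Measurable g → (∀ x, 0 ≤ g x) →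
      ∀ M > (0:ℝ), ∫⁻ y, ENNReal.ofReal (g y) ^ (2 * N / (2 * N - μ)) ≤
        ENNReal.ofReal M ^ (2 * N / (2 * N - μ)) →
      ∫⁻ x, ∫⁻ y, ENNReal.ofReal (g x * g y * ‖x - y‖ ^ (-μ)) ≤ ENNReal.ofReal (C * M ^ 2) := by
  obtain ⟨C, hC, h⟩ := aux_inner N hN μ hμ0 hμN
  have hN' : 0 < (N:ℝ) := by exact_mod_cast hN
  have hd : 0 < 2 * (N:ℝ) - μ := by linarith
  refine ⟨2 * C, by positivity, fun g hgm hg0 M hM hgM => ?_⟩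
  have hI := h g hgm hg0 M hM hgM
  set I : EuclideanSpace ℝ (Fin N) → EuclideanSpace ℝ (Fin N) → ENNReal := fun x y =>
    ENNReal.ofReal (g x * (min (g y) (g x) * ‖x - y‖ ^ (-μ))) with hIdef
  have hIm : Measurable (Function.uncurry I) := by
    simp only [hIdef, Function.uncurry_def]
    fun_prop
  have hpt : ∀ x y, ENNReal.ofReal (g x * g y * ‖x - y‖ ^ (-μ)) ≤ I x y + I y x := by
    intro x y
    have hk : 0 ≤ ‖x - y‖ ^ (-μ) := by positivity
    simp only [hIdef]
    rcases le_total (g y) (g x) with hxy | hxy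
    · refine le_trans ?_ le_self_add
      rw [min_eq_left hxy, mul_assoc]
    · refine le_trans ?_ le_add_self
      rw [min_eq_left hxy, norm_sub_rev y x]
      exact ENNReal.ofReal_le_ofReal (le_of_eq (by ring))
  have hone : ∫⁻ x, ∫⁻ y, I x y ≤ ENNReal.ofReal (C * M ^ 2) := by
    calc ∫⁻ x, ∫⁻ y, I x y ≤ ∫⁻ x, ENNReal.ofReal (C * M ^ (2 * (N - μ) / (2 * N - μ))) *
          ENNReal.ofReal (g x) ^ (2 * N / (2 * N - μ)) := by
          refine lintegral_mono fun x => ?_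
          rcases (hg0 x).eq_or_lt with h0 | h0
          · simp [hIdef, ← h0]
          · simp only [hIdef]
            simp_rw [ENNReal.ofReal_mul (hg0 x)]
            rw [lintegral_const_mul _ (by fun_prop)]
            refine (mul_le_mul_right (hI _ h0 x) _).trans (le_of_eq ?_)
            rw [ENNReal.ofReal_rpow_of_pos h0, ← ENNReal.ofReal_mul (hg0 x), ← ENNReal.ofReal_mul (by positivity),
              show 2 * N / (2 * N - μ) = 1 + μ / (2 * N - μ) by field_simp; ring, Real.rpow_add h0, Real.rpow_one]
            congr 1; ring
      _ = ENNReal.ofReal (C * M ^ (2 * (N - μ) / (2 * N - μ))) *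
          ∫⁻ x, ENNReal.ofReal (g x) ^ (2 * N / (2 * N - μ)) := by
          rw [lintegral_const_mul _ (by fun_prop)]
      _ ≤ _ := mul_le_mul_right hgM _
      _ = _ := by
          rw [ENNReal.ofReal_rpow_of_pos hM, ← ENNReal.ofReal_mul (by positivity), mul_assoc, ← Real.rpow_add hM,
            show 2 * (N - μ) / (2 * N - μ) + 2 * N / (2 * N - μ) = ((2:ℕ):ℝ) by push_cast; field_simp; ring,
            Real.rpow_natCast]
  have hswap : ∫⁻ x, ∫⁻ y, I y x = ∫⁻ x, ∫⁻ y, I x y :=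
    (lintegral_lintegral_swap hIm.aemeasurable).symm
  calc _ ≤ ∫⁻ x, ∫⁻ y, (I x y + I y x) := lintegral_mono fun x => lintegral_mono fun y => hpt x y
    _ = ∫⁻ x, ((∫⁻ y, I x y) + ∫⁻ y, I y x) := by
        refine lintegral_congr fun x => ?_
        have hm : Measurable (fun y => I x y) := hIm.comp measurable_prodMk_left
        rw [lintegral_add_left hm]
    _ = (∫⁻ x, ∫⁻ y, I x y) + ∫⁻ x, ∫⁻ y, I y x := by
        have hm : Measurable (fun x => ∫⁻ y, I x y) := hIm.lintegral_prod_right'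
        rw [lintegral_add_left hm]
    _ ≤ _ := by
        rw [hswap, mul_assoc, two_mul, ENNReal.ofReal_add (by positivity) (by positivity)]
        exact add_le_add hone hone

lemma aux_sobolev (N : ℕ) (p : ℝ) (hp : 1 < p) (hpN : p < N) :
    ∃ K > (0:ℝ), ∀ u : EuclideanSpace ℝ (Fin N) → ℝ, ContDiff ℝ 1 u → HasCompactSupport u →
      ∫⁻ x, ENNReal.ofReal (|u x| ^ (N * p / (N - p))) ≤
        ENNReal.ofReal (K * pDirichlet N p u ^ ((N:ℝ) / (N - p))) := by
  have hN' : 0 < (N:ℝ) := by linarith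
  have hp0 : 0 < p := by linarith
  have hd : 0 < (N:ℝ) - p := by linarith
  have hps : 0 < N * p / ((N:ℝ) - p) := by positivity
  set P : NNReal := ⟨p, hp0.le⟩ with hP
  set S : NNReal := ⟨N * p / ((N:ℝ) - p), hps.le⟩ with hS
  have hPc : (P : ℝ) = p := rfl
  have hSc : (S : ℝ) = N * p / ((N:ℝ) - p) := rfl
  have hP0 : P ≠ 0 := by
    intro h; rw [← NNReal.coe_eq_zero, hPc] at h; exact hp0.ne' h
  have hS0 : S ≠ 0 := by
    intro h; rw [← NNReal.coe_eq_zero, hSc] at h; exact hps.ne' h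
  set K₀ : NNReal := SNormLESNormFDerivOfEqConst ℝ (volume : Measure (EuclideanSpace ℝ (Fin N))) P with hK₀
  refine ⟨((K₀:ℝ) + 1) ^ (N * p / ((N:ℝ) - p)), by positivity, fun u hu hcu => ?_⟩
  have hsob := eLpNorm_le_eLpNorm_fderiv_of_eq (volume : Measure (EuclideanSpace ℝ (Fin N))) hu hcu
    (p := P) (p' := S) (by rw [← NNReal.coe_le_coe, hPc]; exact_mod_cast hp.le)
    (by simp; exact_mod_cast hN') (by
      rw [NNReal.coe_inv, hPc, hSc]; simp only [finrank_euclideanSpace, Fintype.card_fin]; field_simp)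
  have hA : eLpNorm (fderiv ℝ u) P volume ^ p = ENNReal.ofReal (pDirichlet N p u) := by
    have h1 := eLpNorm_nnreal_pow_eq_lintegral (f := fderiv ℝ u) (μ := volume) hP0
    rw [hPc] at h1
    rw [h1, pDirichlet, ofReal_integral_eq_lintegral_ofReal]
    · refine lintegral_congr fun x => ?_
      rw [← ofReal_norm, ENNReal.ofReal_rpow_of_nonneg (norm_nonneg _) hp0.le]
    · refine Continuous.integrable_of_hasCompactSupport ?_ ?_
      · exact ((hu.continuous_fderiv one_ne_zero).norm).rpow_const (fun x => Or.inr hp0.le)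
      · exact (hcu.fderiv ℝ).comp_left (g := fun z => ‖z‖ ^ p) (by simp [hp0.ne'])
    · exact Filter.Eventually.of_forall fun x => Real.rpow_nonneg (norm_nonneg _) _
  have hD0 : 0 ≤ pDirichlet N p u := integral_nonneg fun x => Real.rpow_nonneg (norm_nonneg _) _
  have hL : ∫⁻ x, ENNReal.ofReal (|u x| ^ (N * p / (N - p))) = eLpNorm u S volume ^ (S:ℝ) := by
    rw [eLpNorm_nnreal_pow_eq_lintegral hS0, hSc]
    refine lintegral_congr fun x => ?_
    rw [← ofReal_norm, ENNReal.ofReal_rpow_of_nonneg (norm_nonneg _) hps.le, Real.norm_eq_abs]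
  rw [hL, hSc]
  refine (ENNReal.rpow_le_rpow hsob hps.le).trans ?_
  rw [ENNReal.mul_rpow_of_nonneg _ _ hps.le, ENNReal.ofReal_mul (by positivity)]
  refine mul_le_mul' ?_ (le_of_eq ?_)
  · rw [← ENNReal.ofReal_rpow_of_nonneg (by positivity) hps.le]
    refine ENNReal.rpow_le_rpow ?_ hps.le
    rw [← ENNReal.ofReal_coe_nnreal]
    exact ENNReal.ofReal_le_ofReal (by linarith)
  · rw [← ENNReal.ofReal_rpow_of_nonneg hD0 (by positivity), ← hA, ← ENNReal.rpow_mul]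
    congr 1
    ring

lemma aux_choquard (N : ℕ) (p μ q C₀ : ℝ) (hp : 1 < p) (hpN : p < N) (hμ0 : 0 < μ) (hμN : μ < N)
    (hq1 : p * (2 * N - μ) / (2 * N) < q) (hq2 : q < p * (2 * N - μ) / (2 * (N - p)))
    (F : ℝ → ℝ) (hC₀ : 0 < C₀)
    (hF : ∀ t : ℝ, |F t| ≤ C₀ * (|t| ^ (p * (2 * N - μ) / (2 * N)) + |t| ^ q)) :
    ∃ K > (0:ℝ), ∀ u : EuclideanSpace ℝ (Fin N) → ℝ, ContDiff ℝ 1 u → HasCompactSupport u →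
      ∀ T > (0:ℝ), T ≤ 1 → pDirichlet N p u ≤ T → pMass N p u ≤ T →
      |choquardTerm N μ F u| ≤ K * T ^ ((2 * N - μ) / N) := by
  have hN' : 0 < (N:ℝ) := by linarith
  have hN : 0 < N := by exact_mod_cast hN'
  have hp0 : 0 < p := by linarith
  have hd : 0 < (N:ℝ) - p := by linarith
  have hdμ : 0 < 2 * (N:ℝ) - μ := by linarith
  have hps : 0 < N * p / ((N:ℝ) - p) := by positivity
  obtain ⟨K₁, hK₁, hsob⟩ := aux_sobolev N p hp hpN
  obtain ⟨K₂, hK₂, hhls⟩ := aux_hls N hN μ hμ0 hμN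
  set r : ℝ := 2 * N / (2 * N - μ) with hr
  have hr0 : 0 < r := by positivity
  refine ⟨K₂ * (2 * C₀ * (1 + K₁) ^ (1 / r)) ^ 2, by positivity, fun u hu hcu T hT hT1 hAT hBT => ?_⟩
  set g : EuclideanSpace ℝ (Fin N) → ℝ := fun x =>
    2 * C₀ * (|u x| ^ p + |u x| ^ (N * p / ((N:ℝ) - p))) ^ (1 / r) with hg
  have hum : Measurable u := hu.continuous.measurable
  have hgm : Measurable g := by simp only [hg]; fun_prop
  have hg0 : ∀ x, 0 ≤ g x := fun x => by simp only [hg]; positivity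
  have hFg : ∀ x, |F (u x)| ≤ g x := by
    intro x
    refine (hF _).trans ?_
    have ht : 0 ≤ |u x| := abs_nonneg _
    set t := |u x|
    have hA : t ^ (p * (2 * N - μ) / (2 * N)) ≤ (t ^ p + t ^ (N * p / ((N:ℝ) - p))) ^ (1 / r) := by
      rw [show p * (2 * N - μ) / (2 * N) = p * (1 / r) by rw [hr]; field_simp, Real.rpow_mul ht]
      exact Real.rpow_le_rpow (by positivity) (by linarith [Real.rpow_nonneg ht (N * p / ((N:ℝ) - p))]) (by positivity)
    have hB : t ^ q ≤ (t ^ p + t ^ (N * p / ((N:ℝ) - p))) ^ (1 / r) := by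
      rw [show q = (q * r) * (1 / r) by field_simp, Real.rpow_mul ht]
      refine Real.rpow_le_rpow (by positivity) ?_ (by positivity)
      have h1 : p ≤ q * r := by
        rw [div_lt_iff₀ (by positivity)] at hq1
        rw [hr, ← mul_div_assoc, le_div_iff₀ hdμ]; linarith
      have h2 : q * r ≤ N * p / ((N:ℝ) - p) := by
        rw [lt_div_iff₀ (by positivity)] at hq2
        rw [hr, ← mul_div_assoc, div_le_div_iff₀ hdμ hd]; nlinarith
      rcases le_total t 1 with h | h
      · rcases ht.eq_or_lt with h0 | h0
        · rw [← h0, Real.zero_rpow (by linarith)]; positivity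
        · have := Real.rpow_le_rpow_of_exponent_ge h0 h h1
          linarith [Real.rpow_nonneg ht (N * p / ((N:ℝ) - p))]
      · have := Real.rpow_le_rpow_of_exponent_le h h2
        linarith [Real.rpow_nonneg ht p]
    calc _ ≤ C₀ * (_ + _) := mul_le_mul_of_nonneg_left (add_le_add hA hB) hC₀.le
      _ = _ := by simp only [hg]; ring
  set M : ℝ := 2 * C₀ * ((1 + K₁) * T) ^ (1 / r) with hM
  have hM0 : 0 < M := by positivity
  have hD0 : 0 ≤ pDirichlet N p u := integral_nonneg fun x => Real.rpow_nonneg (norm_nonneg _) _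
  have hmass : ∫⁻ x, ENNReal.ofReal (|u x| ^ p) = ENNReal.ofReal (pMass N p u) := by
    rw [pMass, ofReal_integral_eq_lintegral_ofReal]
    · refine Continuous.integrable_of_hasCompactSupport ?_ ?_
      · exact (hu.continuous.abs).rpow_const (fun x => Or.inr hp0.le)
      · exact hcu.comp_left (g := fun z => |z| ^ p) (by simp [hp0.ne'])
    · exact Filter.Eventually.of_forall fun x => Real.rpow_nonneg (abs_nonneg _) _
  have hgM : ∫⁻ y, ENNReal.ofReal (g y) ^ r ≤ ENNReal.ofReal M ^ r := by
    have e : ∀ y, ENNReal.ofReal (g y) ^ r = ENNReal.ofReal ((2 * C₀) ^ r) *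
        (ENNReal.ofReal (|u y| ^ p) + ENNReal.ofReal (|u y| ^ (N * p / ((N:ℝ) - p)))) := by
      intro y
      rw [ENNReal.ofReal_rpow_of_nonneg (hg0 y) hr0.le, ← ENNReal.ofReal_add (by positivity) (by positivity),
        ← ENNReal.ofReal_mul (by positivity)]
      simp only [hg]
      rw [Real.mul_rpow (by positivity) (by positivity), ← Real.rpow_mul (by positivity),
        one_div_mul_cancel hr0.ne', Real.rpow_one]
    simp_rw [e]
    rw [lintegral_const_mul _ (by fun_prop), lintegral_add_left (by fun_prop), hmass,
      ENNReal.ofReal_rpow_of_nonneg hM0.le hr0.le, hM,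
      Real.mul_rpow (x := 2 * C₀) (y := ((1 + K₁) * T) ^ (1 / r)) (by positivity) (by positivity),
      ← Real.rpow_mul (by positivity), one_div_mul_cancel hr0.ne', Real.rpow_one,
      ENNReal.ofReal_mul (by positivity), add_mul, one_mul, ENNReal.ofReal_add hT.le (by positivity)]
    refine mul_le_mul_right (add_le_add (ENNReal.ofReal_le_ofReal hBT) ((hsob u hu hcu).trans ?_)) _
    refine ENNReal.ofReal_le_ofReal (mul_le_mul_of_nonneg_left ?_ hK₁.le)
    calc pDirichlet N p u ^ ((N:ℝ) / (N - p)) ≤ T ^ ((N:ℝ) / (N - p)) :=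
          Real.rpow_le_rpow hD0 hAT (by positivity)
      _ ≤ T ^ (1:ℝ) := Real.rpow_le_rpow_of_exponent_ge hT hT1 (by rw [le_div_iff₀ hd]; linarith)
      _ = T := Real.rpow_one T
  have hfin := hhls g hgm hg0 M hM0 hgM
  have hD : ‖choquardTerm N μ F u‖ₑ ≤ ENNReal.ofReal (K₂ * M ^ 2) := by
    refine le_trans ?_ hfin
    unfold choquardTerm
    refine (enorm_integral_le_lintegral_enorm _).trans (lintegral_mono fun x => ?_)
    refine (enorm_integral_le_lintegral_enorm _).trans (lintegral_mono fun y => ?_)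
    rw [← ofReal_norm]
    refine ENNReal.ofReal_le_ofReal ?_
    rw [Real.rpow_neg (norm_nonneg _), ← div_eq_mul_inv, Real.norm_eq_abs, abs_div, abs_mul,
      abs_of_nonneg (Real.rpow_nonneg (norm_nonneg (x - y)) μ)]
    exact div_le_div_of_nonneg_right (mul_le_mul (hFg x) (hFg y) (abs_nonneg _) (hg0 x)) (by positivity)
  rw [← ofReal_norm, ENNReal.ofReal_le_ofReal_iff (by positivity), Real.norm_eq_abs] at hD
  refine hD.trans (le_of_eq ?_)
  rw [hM, Real.mul_rpow (by positivity) hT.le, mul_pow, mul_pow, mul_pow,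
    ← Real.rpow_natCast (T ^ (1 / r)), ← Real.rpow_mul hT.le,
    show 1 / r * ((2:ℕ):ℝ) = (2 * N - μ) / N by rw [hr]; push_cast; field_simp]
  ring

lemma aux_alg3 (n p μ a A : ℝ) (hp : p ≠ 0) (hd : 2 * n - μ ≠ 0) :
    (a / p) * A - ((n - p) * a / p) * A / (2 * n - μ) =
        (n - μ) / ((2 * n - μ) * p) * (a * A) + a * A / (2 * n - μ) := by
  obtain ⟨d, rfl⟩ : ∃ d, μ = 2 * n - d := ⟨2 * n - μ, by ring⟩
  rw [sub_sub_cancel] at hd ⊢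
  field_simp
  ring

lemma aux_alg4 (n p μ W : ℝ) (hp : p ≠ 0) (hd : 2 * n - μ ≠ 0) :
    (1 / p) * W - (1 / p) * (n * W) / (2 * n - μ) = (n - μ) / ((2 * n - μ) * p) * W := by
  obtain ⟨d, rfl⟩ : ∃ d, μ = 2 * n - d := ⟨2 * n - μ, by ring⟩
  rw [sub_sub_cancel] at hd ⊢
  field_simp
  ring

/-- The Poho\v{z}aev manifold is bounded away from zero, and `J` is bounded
below by a positive constant on it. -/
theorem pohozaev_manifold_away_from_zero (N : ℕ) (p μ a b θ Vinf q C₀ : ℝ)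
    (hN2 : 2 < (N : ℝ)) (hp : 1 < p) (hpN : p < N)
    (hμ0 : 0 < μ) (hμN : μ < N) (ha : 0 < a) (hb : 0 < b)
    (hθ1 : 1 ≤ θ) (hθ2 : θ < (2 * N - μ) / (N - p)) (hVinf : 0 < Vinf)
    (hq1 : p * (2 * N - μ) / (2 * N) < q) (hq2 : q < p * (2 * N - μ) / (2 * (N - p)))
    (F : ℝ → ℝ) (hC₀ : 0 < C₀)
    (hF : ∀ t : ℝ, |F t| ≤ C₀ * (|t| ^ (p * (2 * N - μ) / (2 * N)) + |t| ^ q))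
    (V : EuclideanSpace ℝ (Fin N) → ℝ) (hVreg : ContDiff ℝ 1 V)
    (hVbdd : BddAbove (Set.range V))
    (hV2 : ∀ x, ⟪gradient V x, x⟫ ≤ 0)
    (hV3 : ∀ x, (N : ℝ) * Vinf ≤ (N : ℝ) * V x + ⟪gradient V x, x⟫) :
    ∃ σ₁ > (0 : ℝ), ∃ σ₂ > (0 : ℝ), ∀ u : EuclideanSpace ℝ (Fin N) → ℝ,
      ContDiff ℝ 1 u → HasCompactSupport u → u ≠ 0 →
      pohozaevP N p μ a b θ F V u = 0 →
      σ₁ < (a * pDirichlet N p u + ∫ x, V x * |u x| ^ p) ^ (1 / p) ∧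
        σ₂ ≤ energyJ N p μ a b θ F V u := by
  have hN' : 0 < (N:ℝ) := by linarith
  have hp0 : 0 < p := by linarith
  have hd : 0 < (N:ℝ) - p := by linarith
  have hdμ : 0 < 2 * (N:ℝ) - μ := by linarith
  have hNμ : 0 < (N:ℝ) - μ := by linarith
  obtain ⟨K, hK, hD⟩ := aux_choquard N p μ q C₀ hp hpN hμ0 hμN hq1 hq2 F hC₀ hF
  obtain ⟨Vm, hVm⟩ := hVbdd
  have hVle : ∀ x, V x ≤ Vm := fun x => hVm ⟨x, rfl⟩
  have hVge : ∀ x, Vinf ≤ V x := by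
    intro x
    have h1 := hV2 x
    have h2 := hV3 x
    exact le_of_mul_le_mul_left (by linarith) hN'
  have hVm0 : 0 < Vm := hVinf.trans_le ((hVge 0).trans (hVle 0))
  set κ : ℝ := 1 / a + 1 / Vinf with hκ
  have hκ0 : 0 < κ := by positivity
  set c : ℝ := min ((N - p) / p) (N * Vinf / (p * Vm)) with hc
  have hc0 : 0 < c := lt_min (by positivity) (by positivity)
  set s : ℝ := (2 * N - μ) / N - 1 with hs
  have hs0 : 0 < s := by
    rw [hs, sub_pos, lt_div_iff₀ hN']; linarith
  set c₂ : ℝ := 2 * c / (κ * (2 * N - μ) * K) with hc₂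
  have hc₂0 : 0 < c₂ := by positivity
  set δ : ℝ := min 1 (c₂ ^ (1 / s)) with hδ
  have hδ0 : 0 < δ := lt_min one_pos (by positivity)
  refine ⟨(δ / (2 * κ)) ^ (1 / p), by positivity, (N - μ) / ((2 * N - μ) * p) * (δ / κ), by positivity,
    fun u hu hcu hu0 hP => ?_⟩
  set A := pDirichlet N p u with hA
  set B := pMass N p u with hB
  set W := ∫ x, V x * |u x| ^ p with hW
  set G := ∫ x, ((N : ℝ) * V x + ⟪gradient V x, x⟫) * |u x| ^ p with hG
  set D := choquardTerm N μ F u with hDdef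
  have hA0 : 0 ≤ A := integral_nonneg fun x => Real.rpow_nonneg (norm_nonneg _) _
  have hup : Continuous (fun x => |u x| ^ p) := (hu.continuous.abs).rpow_const (fun x => Or.inr hp0.le)
  have hcup : HasCompactSupport (fun x => |u x| ^ p) :=
    hcu.comp_left (g := fun z => |z| ^ p) (by simp [hp0.ne'])
  have hup0 : ∀ x, 0 ≤ |u x| ^ p := fun x => Real.rpow_nonneg (abs_nonneg _) _
  have hgrad : Continuous (fun x => gradient V x) := by
    unfold gradient
    exact (LinearIsometryEquiv.continuous _).comp (hVreg.continuous_fderiv one_ne_zero)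
  have hint : ∀ f : EuclideanSpace ℝ (Fin N) → ℝ, Continuous f → Integrable (fun x => f x * |u x| ^ p) :=
    fun f hf => (hf.mul hup).integrable_of_hasCompactSupport hcup.mul_left
  have hintB : Integrable (fun x => |u x| ^ p) := hup.integrable_of_hasCompactSupport hcup
  have hB0 : 0 < B := by
    refine hup.integral_pos_of_hasCompactSupport_nonneg_nonzero hcup hup0 (x := ?_) ?_
    · exact (Function.ne_iff.1 hu0).choose
    · have := (Function.ne_iff.1 hu0).choose_spec
      exact (Real.rpow_pos_of_pos (abs_pos.2 this) p).ne'
  have hVc := hVreg.continuous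
  have hGc : Continuous (fun x => (N : ℝ) * V x + ⟪gradient V x, x⟫) :=
    (hVc.const_mul _ |> fun h => h).add (hgrad.inner continuous_id)
  have hW1 : Vinf * B ≤ W := by
    rw [hB, pMass, ← integral_const_mul]
    exact integral_mono (hintB.const_mul _) (hint V hVc)
      fun x => mul_le_mul_of_nonneg_right (hVge x) (hup0 x)
  have hW2 : W ≤ Vm * B := by
    rw [hB, pMass, ← integral_const_mul]
    exact integral_mono (hint V hVc) (hintB.const_mul _)
      fun x => mul_le_mul_of_nonneg_right (hVle x) (hup0 x)
  have hG1 : N * Vinf * B ≤ G := by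
    rw [hB, pMass, ← integral_const_mul]
    exact integral_mono (hintB.const_mul _) (hint _ hGc)
      fun x => mul_le_mul_of_nonneg_right (hV3 x) (hup0 x)
  have hG2 : G ≤ N * W := by
    rw [hW, ← integral_const_mul]
    refine integral_mono (hint _ hGc) ((hint V hVc).const_mul _) fun x => ?_
    simp only
    rw [← mul_assoc]
    exact mul_le_mul_of_nonneg_right (by linarith [hV2 x]) (hup0 x)
  have hAθ : 0 ≤ A ^ θ := Real.rpow_nonneg hA0 _
  have hPeq : (((N : ℝ) - p) * a / p) * A + (((N : ℝ) - p) * b / p) * A ^ θ + (1 / p) * G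
    - ((2 * N - μ) / 2) * D = 0 := hP
  set T₀ := a * A + W with hT₀
  have hW0 : 0 < W := lt_of_lt_of_le (by positivity) hW1
  have hT₀0 : 0 < T₀ := by positivity
  have hlow : c * T₀ ≤ ((2 * N - μ) / 2) * D := by
    have h1 : c * (a * A) ≤ (N - p) / p * (a * A) :=
      mul_le_mul_of_nonneg_right (min_le_left _ _) (by positivity)
    have h2 : c * W ≤ (1 / p) * G := by
      calc c * W ≤ (N * Vinf / (p * Vm)) * (Vm * B) :=
            mul_le_mul (min_le_right _ _) hW2 hW0.le (by positivity)
        _ = (1 / p) * (N * Vinf * B) := by field_simp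
        _ ≤ _ := mul_le_mul_of_nonneg_left hG1 (by positivity)
    have h3 : 0 ≤ (((N : ℝ) - p) * b / p) * A ^ θ := by positivity
    have h4 : (N - p) / p * (a * A) = (((N : ℝ) - p) * a / p) * A := by ring
    rw [hT₀, mul_add]
    linarith
  have hT : δ ≤ κ * T₀ := by
    rcases le_or_gt (κ * T₀) 1 with h1 | h1
    · set T := κ * T₀ with hTdef
      have hTpos : 0 < T := by positivity
      have hAT : A ≤ T := by
        have : A = 1 / a * (a * A) := by field_simp
        rw [this, hTdef]
        exact mul_le_mul (by rw [hκ]; linarith [one_div_pos.2 hVinf]) (by linarith) (by positivity) hκ0.le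
      have hBT : B ≤ T := by
        have : B = 1 / Vinf * (Vinf * B) := by field_simp
        rw [this, hTdef]
        refine mul_le_mul (by rw [hκ]; linarith [one_div_pos.2 ha]) ?_ (by positivity) hκ0.le
        have : 0 ≤ a * A := by positivity
        linarith
      have hDT := (le_abs_self _).trans (hD u hu hcu T hTpos h1 hAT hBT)
      have hpow : T ^ ((2 * N - μ) / N) = T ^ s * T := by
        rw [show (2 * N - μ) / N = s + 1 by rw [hs]; ring, Real.rpow_add hTpos, Real.rpow_one]
      have h5 : c * T₀ ≤ (2 * N - μ) / 2 * (K * (T ^ s * T)) := by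
        rw [← hpow]
        exact hlow.trans (mul_le_mul_of_nonneg_left hDT (by positivity))
      have h6 : c₂ ≤ T ^ s := by
        rw [hc₂, div_le_iff₀ (by positivity)]
        refine le_of_mul_le_mul_right ?_ hT₀0
        rw [hTdef] at h5 ⊢
        linarith
      refine (min_le_right _ _).trans ?_
      calc c₂ ^ (1 / s) ≤ (T ^ s) ^ (1 / s) := Real.rpow_le_rpow hc₂0.le h6 (by positivity)
        _ = T := by rw [← Real.rpow_mul hTpos.le, mul_one_div_cancel hs0.ne', Real.rpow_one]
    · exact (min_le_left _ _).trans h1.le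
  have hT' : δ / κ ≤ T₀ := by rw [div_le_iff₀ hκ0]; linarith
  constructor
  · refine Real.rpow_lt_rpow (by positivity) (lt_of_lt_of_le ?_ hT') (by positivity)
    exact div_lt_div_of_pos_left hδ0 hκ0 (by linarith)
  · refine (mul_le_mul_of_nonneg_left hT' (by positivity)).trans ?_
    change _ ≤ (a / p) * A + (b / (p * θ)) * A ^ θ + (1 / p) * W - D / 2
    have hDval : D / 2 = ((((N : ℝ) - p) * a / p) * A + (((N : ℝ) - p) * b / p) * A ^ θ + (1 / p) * G)
        / (2 * N - μ) := by
      rw [eq_div_iff hdμ.ne']; linarith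
    have hθ0 : 0 < θ := by linarith
    have i1 : (((N : ℝ) - p) * b / p) * A ^ θ / (2 * N - μ) ≤ (b / (p * θ)) * A ^ θ := by
      rw [lt_div_iff₀ hd] at hθ2
      rw [mul_div_right_comm]
      refine mul_le_mul_of_nonneg_right ?_ hAθ
      rw [div_div, div_le_div_iff₀ (by positivity) (by positivity)]
      have := mul_le_mul_of_nonneg_left hθ2.le (mul_pos hb hp0).le
      linarith only [this]
    have i2 : (1 / p) * G / (2 * N - μ) ≤ (1 / p) * (N * W) / (2 * N - μ) := by gcongr
    have i3 : (a / p) * A - (((N : ℝ) - p) * a / p) * A / (2 * N - μ) =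
        (N - μ) / ((2 * N - μ) * p) * (a * A) + a * A / (2 * N - μ) := by
      exact aux_alg3 _ _ _ _ _ hp0.ne' hdμ.ne'
    have i4 : (1 / p) * W - (1 / p) * (N * W) / (2 * N - μ) = (N - μ) / ((2 * N - μ) * p) * W := by
      exact aux_alg4 _ _ _ _ hp0.ne' hdμ.ne'
    have i5 : 0 ≤ a * A / (2 * N - μ) := by positivity
    rw [hDval, add_div, add_div, hT₀, mul_add]
    linarith
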